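/- The inverse α₁⁻¹ of α₁: [-1,+∞) → [0,+∞) is a strictly increasing C¹ function on [0,+∞) with (α₁⁻¹)'(s) = 1/(α₁' ∘ α₁⁻¹(s)) for s ∈ ℝ₊ \ {0, 16}, (α₁⁻¹)'(0) = 1/(2π), and (α₁⁻¹)'(16) = 0. -/

import Mathlib

open Real Set

noncomputable def theta1 (e : ℝ) : ℝ := Real.arccos (-e)

noncomputable def alpha1 (e : ℝ) : ℝ :=
  4 * Real.sqrt 2 * ∫ θ in (0:ℝ)..(theta1 e), Real.sqrt (e + Real.cos θ)

noncomputable def dalpha1 (e : ℝ) : ℝ :=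
  2 * Real.sqrt 2 * ∫ θ in (0:ℝ)..(theta1 e), 1 / Real.sqrt (e + Real.cos θ)

open MeasureTheory Filter Topology

lemma one_div_sqrt_eq_rpow (x : ℝ) : 1 / √x = x ^ (-(1 / 2) : ℝ) := by
  rcases lt_trichotomy x 0 with h | rfl | h
  · rw [Real.sqrt_eq_zero_of_nonpos h.le, Real.rpow_def_of_neg h, neg_mul, Real.cos_neg]
    simp [inv_mul_eq_div]
  · norm_num [Real.zero_rpow]
  · rw [Real.rpow_neg h.le, Real.sqrt_eq_rpow, one_div]

lemma intervalIntegrable_one_div_sqrt (a b : ℝ) :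
    IntervalIntegrable (fun x => 1 / √x) volume a b := by
  simp_rw [one_div_sqrt_eq_rpow]
  exact intervalIntegral.intervalIntegrable_rpow' (by norm_num)

lemma integral_one_div_sqrt (a b : ℝ) : ∫ x in a..b, 1 / √x = 2 * (√b - √a) := by
  simp_rw [one_div_sqrt_eq_rpow]
  rw [integral_rpow (Or.inl (by norm_num))]
  norm_num [Real.sqrt_eq_rpow]
  ring

lemma continuousAt_integral_one_div_sqrt {F : ℝ → ℝ → ℝ} (hF : Continuous (Function.uncurry F))
    {a b e : ℝ} (hab : a ≤ b) (hpos : ∀ x ∈ Icc a b, 0 < F e x) :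
    ContinuousAt (fun t => ∫ x in a..b, 1 / √(F t x)) e := by
  obtain ⟨x₀, hx₀, hmin⟩ := isCompact_Icc.exists_isMinOn (nonempty_Icc.2 hab)
    (show ContinuousOn (F e) (Icc a b) from (hF.comp (by fun_prop : Continuous fun x => (e, x))).continuousOn)
  set c := F e x₀ / 2
  have hc : 0 < c := half_pos (hpos x₀ hx₀)
  have hev : ∀ᶠ t in 𝓝 e, ∀ x ∈ Icc a b, c < F t x := by
    refine isCompact_Icc.eventually_forall_of_forall_eventually fun x hx => ?_
    exact (hF.tendsto (e, x)).eventually_const_lt ((half_lt_self (hpos x₀ hx₀)).trans_le (hmin hx))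
  have hcont : Continuous fun t => ∫ x in a..b, 1 / √(max (F t x) c) := by
    apply intervalIntegral.continuous_parametric_intervalIntegral_of_continuous'
    refine continuous_const.div (hF.max continuous_const).sqrt fun p => ?_
    exact (Real.sqrt_pos.2 (hc.trans_le (le_max_right _ _))).ne'
  refine hcont.continuousAt.congr ?_
  filter_upwards [hev] with t ht
  refine intervalIntegral.integral_congr fun x hx => ?_
  rw [uIcc_of_le hab] at hx
  simp only [max_eq_left (ht x hx).le]

lemma integral_theta1_eq {h : ℝ → ℝ} (h0 : ∀ x ≤ 0, h x = 0) (e : ℝ) :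
    ∫ θ in (0 : ℝ)..theta1 e, h (e + cos θ) = ∫ θ in (0 : ℝ)..π, h (e + cos θ) := by
  rw [theta1, intervalIntegral.integral_of_le (arccos_nonneg _),
    intervalIntegral.integral_of_le pi_pos.le]
  refine (setIntegral_eq_of_subset_of_forall_sdiff_eq_zero measurableSet_Ioc
    (Ioc_subset_Ioc_right (arccos_le_pi _)) ?_).symm
  rintro θ ⟨⟨h1, h2⟩, h3⟩
  refine h0 _ (not_lt.1 fun hlt => h3 ⟨h1, ?_⟩)
  have := antitone_arccos (show -e ≤ cos θ by linarith)
  rwa [arccos_cos h1.le h2] at this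

lemma alpha1_eq (e : ℝ) : alpha1 e = 4 * √2 * ∫ θ in (0 : ℝ)..π, √(e + cos θ) := by
  rw [alpha1, integral_theta1_eq (h := fun x => √x) fun x hx => Real.sqrt_eq_zero_of_nonpos hx]

lemma dalpha1_eq (e : ℝ) : dalpha1 e = 2 * √2 * ∫ θ in (0 : ℝ)..π, 1 / √(e + cos θ) := by
  rw [dalpha1, integral_theta1_eq (h := fun x => 1 / √x) fun x hx => by
    simp [Real.sqrt_eq_zero_of_nonpos hx]]

lemma alpha1_mono : Monotone alpha1 := by
  intro a b hab
  rw [alpha1_eq, alpha1_eq]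
  gcongr
  exact intervalIntegral.integral_mono_on pi_pos.le
    ((by fun_prop : Continuous fun θ => √(a + cos θ)).intervalIntegrable 0 π)
    ((by fun_prop : Continuous fun θ => √(b + cos θ)).intervalIntegrable 0 π)
    fun θ _ => by gcongr

lemma alpha1_neg_one : alpha1 (-1) = 0 := by simp [alpha1, theta1]

lemma alpha1_one : alpha1 1 = 16 := by
  have h : ∀ θ ∈ uIcc 0 π, √(1 + cos θ) = √2 * cos (θ / 2) := fun θ hθ => by
    rw [uIcc_of_le pi_pos.le] at hθ
    have hc : 0 ≤ cos (θ / 2) := cos_nonneg_of_mem_Icc ⟨by linarith [hθ.1, pi_pos], by linarith [hθ.2]⟩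
    have h2 : 1 + cos θ = 2 * cos (θ / 2) ^ 2 := by
      rw [Real.cos_sq]; ring_nf
    rw [h2, Real.sqrt_mul zero_le_two, Real.sqrt_sq hc]
  rw [alpha1_eq, intervalIntegral.integral_congr h, intervalIntegral.integral_const_mul,
    intervalIntegral.integral_comp_div (fun x => cos x) two_ne_zero]
  simp
  nlinarith [Real.mul_self_sqrt (zero_le_two (α := ℝ))]

lemma integrable_one_div_sqrt_add_cos {a b : ℝ} (hab : a ≤ b) :
    Integrable (Function.uncurry fun t θ : ℝ => 1 / √(t + cos θ))
      ((volume.restrict (Ioc a b)).prod (volume.restrict (Ioc 0 π))) := by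
  have hint (θ : ℝ) : IntervalIntegrable (fun t => 1 / √(t + cos θ)) volume a b := by
    simpa using (intervalIntegrable_one_div_sqrt (a + cos θ) (b + cos θ)).comp_add_right (cos θ)
  have hm : Measurable (Function.uncurry fun t θ : ℝ => 1 / √(t + cos θ)) := by
    unfold Function.uncurry; fun_prop
  refine (integrable_prod_iff' hm.aestronglyMeasurable).2 ⟨.of_forall fun θ => ?_, ?_⟩
  · exact (intervalIntegrable_iff_integrableOn_Ioc_of_le hab).1 (hint θ)
  · have : (fun θ => ∫ t in Ioc a b, ‖Function.uncurry (fun t θ : ℝ => 1 / √(t + cos θ)) (t, θ)‖)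
        = fun θ => 2 * (√(b + cos θ) - √(a + cos θ)) := by
      ext θ
      rw [← integral_one_div_sqrt, ← intervalIntegral.integral_comp_add_right,
        intervalIntegral.integral_of_le hab]
      refine integral_congr_ae (.of_forall fun t => ?_)
      simp [Function.uncurry, abs_of_nonneg (Real.sqrt_nonneg _)]
    rw [this]
    exact ((by fun_prop : Continuous fun θ => 2 * (√(b + cos θ) - √(a + cos θ))).integrableOn_Icc).mono_set
      Ioc_subset_Icc_self

lemma intervalIntegrable_dalpha1 {a b : ℝ} (hab : a ≤ b) :
    IntervalIntegrable dalpha1 volume a b := by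
  rw [intervalIntegrable_iff_integrableOn_Ioc_of_le hab]
  have := (integrable_one_div_sqrt_add_cos hab).integral_prod_left.const_mul (2 * √2)
  refine this.congr (.of_forall fun t => ?_)
  simp only [dalpha1_eq, intervalIntegral.integral_of_le pi_pos.le]
  rfl

lemma integral_dalpha1 {a b : ℝ} (hab : a ≤ b) :
    ∫ t in a..b, dalpha1 t = alpha1 b - alpha1 a := by
  have hint (e : ℝ) : IntervalIntegrable (fun θ => √(e + cos θ)) volume 0 π :=
    (by fun_prop : Continuous fun θ => √(e + cos θ)).intervalIntegrable _ _
  have key : ∫ t in a..b, ∫ θ in (0 : ℝ)..π, 1 / √(t + cos θ)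
      = ∫ θ in (0 : ℝ)..π, ∫ t in a..b, 1 / √(t + cos θ) := by
    simp only [intervalIntegral.integral_of_le hab, intervalIntegral.integral_of_le pi_pos.le]
    exact integral_integral_swap (integrable_one_div_sqrt_add_cos hab)
  simp only [dalpha1_eq, intervalIntegral.integral_const_mul]
  rw [key]
  simp only [intervalIntegral.integral_comp_add_right (fun x => 1 / √x), integral_one_div_sqrt]
  rw [intervalIntegral.integral_const_mul, intervalIntegral.integral_sub (hint b) (hint a),
    alpha1_eq, alpha1_eq]
  ring

/-- The complete elliptic integral of the first kind, as a function of the parameter `m = k²`. -/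
noncomputable def ellipticK (m : ℝ) : ℝ := ∫ φ in (0 : ℝ)..(π / 2), 1 / √(1 - m * sin φ ^ 2)

lemma one_sub_mul_sin_sq_pos {m : ℝ} (hm : m < 1) (φ : ℝ) : 0 < 1 - m * sin φ ^ 2 := by
  rcases (sin_sq_le_one φ).lt_or_eq with h | h
  · nlinarith [mul_nonneg (sub_nonneg.2 hm.le) (sq_nonneg (sin φ))]
  · rw [h]; linarith

lemma continuousAt_ellipticK {m : ℝ} (hm : m < 1) : ContinuousAt ellipticK m :=
  continuousAt_integral_one_div_sqrt (F := fun m φ => 1 - m * sin φ ^ 2)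
    (by unfold Function.uncurry; fun_prop) (by positivity) fun φ _ => one_sub_mul_sin_sq_pos hm φ

lemma ellipticK_zero : ellipticK 0 = π / 2 := by simp [ellipticK]

lemma ellipticK_pos {m : ℝ} (hm : m < 1) : 0 < ellipticK m := by
  refine intervalIntegral.intervalIntegral_pos_of_pos ?_ (fun φ => ?_) (by positivity)
  · refine Continuous.intervalIntegrable ?_ _ _
    refine continuous_const.div (by fun_prop) fun φ => ?_
    exact (Real.sqrt_pos.2 (one_sub_mul_sin_sq_pos hm φ)).ne'
  · exact one_div_pos.2 (Real.sqrt_pos.2 (one_sub_mul_sin_sq_pos hm φ))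

lemma cos_two_mul_arcsin {y : ℝ} (h₁ : -1 ≤ y) (h₂ : y ≤ 1) : cos (2 * arcsin y) = 1 - 2 * y ^ 2 := by
  rw [cos_two_mul, cos_sq', sin_arcsin h₁ h₂]; ring

lemma image_two_mul_arcsin {k : ℝ} (h0 : 0 < k) (h1 : k < 1) :
    (fun φ => 2 * arcsin (k * sin φ)) '' Ioo 0 (π / 2) = Ioo 0 (arccos (1 - 2 * k ^ 2)) := by
  have hk2 : k ^ 2 < 1 := by nlinarith
  ext θ
  constructor
  · rintro ⟨φ, ⟨hφ0, hφ1⟩, rfl⟩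
    have hs0 : 0 < sin φ := sin_pos_of_pos_of_lt_pi hφ0 (by linarith)
    have hs1 : sin φ < 1 := by
      simpa using sin_lt_sin_of_lt_of_le_pi_div_two (by linarith) le_rfl hφ1
    have hy0 : 0 < k * sin φ := mul_pos h0 hs0
    have hy1 : k * sin φ < k := by nlinarith
    have hpos : 0 < arcsin (k * sin φ) := arcsin_pos.2 hy0
    refine ⟨by positivity, ?_⟩
    have hc := cos_two_mul_arcsin (y := k * sin φ) (by linarith) (by linarith)
    simp only
    rw [← arccos_cos (x := 2 * arcsin (k * sin φ)) (by positivity)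
      (by linarith [arcsin_le_pi_div_two (k * sin φ)]), hc]
    exact strictAntiOn_arccos ⟨by nlinarith, by nlinarith⟩ ⟨by nlinarith, by nlinarith⟩
      (by nlinarith)
  · rintro ⟨hθ0, hθ1⟩
    have hθπ : θ ≤ π := hθ1.le.trans (arccos_le_pi _)
    have hs0 : 0 < sin (θ / 2) := sin_pos_of_pos_of_lt_pi (by linarith) (by linarith)
    have hlt : sin (θ / 2) < k := by
      have h2 := strictAntiOn_cos ⟨hθ0.le, hθπ⟩ ⟨arccos_nonneg _, arccos_le_pi _⟩ hθ1
      rw [cos_arccos (by nlinarith) (by nlinarith)] at h2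
      have h3 : cos θ = 1 - 2 * sin (θ / 2) ^ 2 := by
        rw [Real.sin_sq, Real.cos_sq]; ring_nf
      exact lt_of_pow_lt_pow_left₀ 2 h0.le (by linarith)
    have hq1 : sin (θ / 2) / k < 1 := (div_lt_one h0).2 hlt
    have hq0 : 0 < sin (θ / 2) / k := by positivity
    refine ⟨arcsin (sin (θ / 2) / k), ⟨arcsin_pos.2 hq0, arcsin_lt_pi_div_two.2 hq1⟩, ?_⟩
    simp only
    rw [sin_arcsin (by linarith) hq1.le, mul_div_cancel₀ _ h0.ne', arcsin_sin (by linarith) (by linarith)]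
    ring

lemma dalpha1_eq_ellipticK {e : ℝ} (h0 : -1 < e) (h1 : e < 1) :
    dalpha1 e = 4 * ellipticK ((1 + e) / 2) := by
  set m := (1 + e) / 2 with hm
  set k := √m
  have hm0 : 0 < m := by rw [hm]; linarith
  have hm1 : m < 1 := by rw [hm]; linarith
  have hk : k ^ 2 = m := Real.sq_sqrt hm0.le
  have hk0 : 0 < k := Real.sqrt_pos.2 hm0
  have hk1 : k < 1 := by nlinarith
  have hθ : theta1 e = arccos (1 - 2 * k ^ 2) := by rw [theta1, hk, hm]; ring_nf
  have hy (φ : ℝ) : (k * sin φ) ^ 2 < 1 := by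
    rw [mul_pow, hk]; linarith [one_sub_mul_sin_sq_pos hm1 φ]
  have hy' (φ : ℝ) : -1 < k * sin φ ∧ k * sin φ < 1 := abs_lt.1 ((sq_lt_one_iff_abs_lt_one _).1 (hy φ))
  have hinj : InjOn (fun φ => 2 * arcsin (k * sin φ)) (Ioo 0 (π / 2)) := by
    intro x hx y hy h
    have h2 := injOn_arcsin ⟨(hy' x).1.le, (hy' x).2.le⟩ ⟨(hy' y).1.le, (hy' y).2.le⟩
      (mul_left_cancel₀ two_ne_zero h)
    exact injOn_sin ⟨by linarith [hx.1, pi_pos], hx.2.le⟩ ⟨by linarith [hy.1, pi_pos], hy.2.le⟩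
      (mul_left_cancel₀ hk0.ne' h2)
  have hder (φ : ℝ) (_ : φ ∈ Ioo 0 (π / 2)) : HasDerivWithinAt (fun φ => 2 * arcsin (k * sin φ))
      (2 * (1 / √(1 - (k * sin φ) ^ 2) * (k * cos φ))) (Ioo 0 (π / 2)) φ :=
    ((HasDerivAt.comp (h₂ := arcsin) (h := fun φ => k * sin φ) φ
      (hasDerivAt_arcsin (hy' φ).1.ne' (hy' φ).2.ne)
      ((hasDerivAt_sin φ).const_mul k)).const_mul 2).hasDerivWithinAt
  rw [dalpha1, hθ, ellipticK, intervalIntegral.integral_of_le (arccos_nonneg _),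
    intervalIntegral.integral_of_le (by positivity), integral_Ioc_eq_integral_Ioo,
    integral_Ioc_eq_integral_Ioo, ← image_two_mul_arcsin hk0 hk1,
    integral_image_eq_integral_abs_deriv_smul measurableSet_Ioo hder hinj,
    ← integral_const_mul, ← integral_const_mul]
  refine setIntegral_congr_fun measurableSet_Ioo fun φ hφ => ?_
  have hc : 0 < cos φ := cos_pos_of_mem_Ioo ⟨by linarith [hφ.1, pi_pos], hφ.2⟩
  have hD : 0 < √(1 - m * sin φ ^ 2) := Real.sqrt_pos.2 (one_sub_mul_sin_sq_pos hm1 φ)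
  have hE : e + cos (2 * arcsin (k * sin φ)) = 2 * (k * cos φ) ^ 2 := by
    rw [cos_two_mul_arcsin (hy' φ).1.le (hy' φ).2.le, mul_pow, mul_pow, hk, cos_sq', hm]; ring
  simp only [hE, smul_eq_mul]
  rw [mul_pow k, hk, Real.sqrt_mul zero_le_two, Real.sqrt_sq (by positivity),
    abs_of_pos (by positivity)]
  field_simp
  norm_num

lemma dalpha1_pos {e : ℝ} (h0 : -1 < e) (h1 : e ≠ 1) : 0 < dalpha1 e := by
  rcases h1.lt_or_gt with h | h
  · rw [dalpha1_eq_ellipticK h0 h]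
    exact mul_pos (by norm_num) (ellipticK_pos (by linarith))
  · have hp (θ : ℝ) : 0 < √(e + cos θ) := Real.sqrt_pos.2 (by linarith [neg_one_le_cos θ])
    rw [dalpha1_eq]
    refine mul_pos (by positivity)
      (intervalIntegral.intervalIntegral_pos_of_pos ?_ (fun θ => one_div_pos.2 (hp θ)) pi_pos)
    exact (continuous_const.div (by fun_prop) fun θ => (hp θ).ne').intervalIntegrable _ _

lemma continuousAt_dalpha1 {e : ℝ} (h0 : -1 < e) (h1 : e ≠ 1) : ContinuousAt dalpha1 e := by
  rcases h1.lt_or_gt with h | h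
  · have : ContinuousAt (fun t => 4 * ellipticK ((1 + t) / 2)) e :=
      continuousAt_const.mul (ContinuousAt.comp (f := fun t : ℝ => (1 + t) / 2)
        (continuousAt_ellipticK (by linarith)) (by fun_prop))
    refine this.congr ?_
    filter_upwards [Ioo_mem_nhds h0 h] with t ht
    exact (dalpha1_eq_ellipticK ht.1 ht.2).symm
  · rw [funext dalpha1_eq]
    exact continuousAt_const.mul (continuousAt_integral_one_div_sqrt (F := fun t θ => t + cos θ)
      (by unfold Function.uncurry; fun_prop) pi_pos.le fun θ _ => by linarith [neg_one_le_cos θ])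

lemma hasDerivAt_alpha1 {e : ℝ} (h0 : -1 < e) (h1 : e ≠ 1) : HasDerivAt alpha1 (dalpha1 e) e := by
  have hopen : IsOpen (Ioi (-1 : ℝ) ∩ {1}ᶜ) := isOpen_Ioi.inter isOpen_compl_singleton
  have h := intervalIntegral.integral_hasDerivAt_right (intervalIntegrable_dalpha1 h0.le)
    (ContinuousAt.stronglyMeasurableAtFilter hopen (fun x hx => continuousAt_dalpha1 hx.1 hx.2) e
      ⟨h0, h1⟩) (continuousAt_dalpha1 h0 h1)
  refine h.congr_of_eventuallyEq ?_
  filter_upwards [Ioi_mem_nhds h0] with t ht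
  rw [integral_dalpha1 (le_of_lt ht), alpha1_neg_one, sub_zero]

lemma tendsto_dalpha1_neg_one : Tendsto dalpha1 (𝓝[>] (-1)) (𝓝 (2 * π)) := by
  have hc : ContinuousAt (fun t => 4 * ellipticK ((1 + t) / 2)) (-1) :=
    continuousAt_const.mul (ContinuousAt.comp (f := fun t : ℝ => (1 + t) / 2)
      (continuousAt_ellipticK (by norm_num)) (by fun_prop))
  have h := hc.tendsto.mono_left (nhdsWithin_le_nhds (s := Ioi (-1)))
  have hv : 4 * ellipticK ((1 + -1) / 2) = 2 * π := by
    rw [show ((1 : ℝ) + -1) / 2 = 0 by norm_num, ellipticK_zero]; ring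
  rw [hv] at h
  refine h.congr' ?_
  filter_upwards [Ioo_mem_nhdsGT (show (-1 : ℝ) < 1 by norm_num)] with t ht
  exact (dalpha1_eq_ellipticK ht.1 ht.2).symm

lemma one_div_le_one_div_sqrt_one_add_cos {θ : ℝ} (h0 : 0 ≤ θ) (h1 : θ < π) :
    1 / (π - θ) ≤ 1 / √(1 + cos θ) := by
  have hpos : 0 < 1 + cos θ := by
    have := strictAntiOn_cos ⟨h0, h1.le⟩ ⟨pi_pos.le, le_rfl⟩ h1
    rw [cos_pi] at this
    linarith
  refine one_div_le_one_div_of_le (Real.sqrt_pos.2 hpos) (Real.sqrt_le_iff.2 ⟨by linarith, ?_⟩)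
  have := one_sub_sq_div_two_le_cos (x := π - θ)
  rw [cos_pi_sub] at this
  nlinarith [sq_nonneg (π - θ)]

lemma tendsto_dalpha1_one : Tendsto dalpha1 (𝓝[≠] 1) atTop := by
  refine tendsto_atTop.2 fun M => ?_
  obtain ⟨x, hx0, hxπ, hxM⟩ : ∃ x, 0 ≤ x ∧ x < π ∧ M < ∫ θ in (0 : ℝ)..x, 1 / (π - θ) := by
    refine ⟨π - π * exp (-(|M| + 1)), ?_, ?_, ?_⟩
    · have : exp (-(|M| + 1)) ≤ 1 := exp_le_one_iff.2 (by linarith [abs_nonneg M])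
      nlinarith [pi_pos]
    · have := mul_pos pi_pos (exp_pos (-(|M| + 1)))
      linarith
    · rw [intervalIntegral.integral_comp_sub_left (fun y => 1 / y), sub_zero, sub_sub_cancel,
        integral_one_div_of_pos (by positivity) pi_pos, div_mul_cancel_left₀ pi_pos.ne',
        exp_neg, inv_inv, log_exp]
      linarith [le_abs_self M]
  have hpos (θ : ℝ) (hθ : θ ∈ Icc 0 x) : 0 < 1 + cos θ := by
    have := strictAntiOn_cos ⟨hθ.1, hθ.2.trans hxπ.le⟩ ⟨pi_pos.le, le_rfl⟩ (hθ.2.trans_lt hxπ)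
    rw [cos_pi] at this
    linarith
  have hc : ContinuousAt (fun t => ∫ θ in (0 : ℝ)..x, 1 / √(t + cos θ)) 1 :=
    continuousAt_integral_one_div_sqrt (F := fun t θ => t + cos θ)
      (by unfold Function.uncurry; fun_prop) hx0 hpos
  have hM : M < ∫ θ in (0 : ℝ)..x, 1 / √(1 + cos θ) := by
    refine hxM.trans_le (intervalIntegral.integral_mono_on hx0 ?_ ?_ fun θ hθ =>
      one_div_le_one_div_sqrt_one_add_cos hθ.1 (hθ.2.trans_lt hxπ))
    · refine ContinuousOn.intervalIntegrable_of_Icc hx0 ?_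
      exact continuousOn_const.div (by fun_prop) fun θ hθ => by linarith [hθ.2]
    · refine ContinuousOn.intervalIntegrable_of_Icc hx0 ?_
      exact continuousOn_const.div (by fun_prop) fun θ hθ => (Real.sqrt_pos.2 (hpos θ hθ)).ne'
  filter_upwards [nhdsWithin_le_nhds (hc.eventually_const_lt hM),
    nhdsWithin_le_nhds (Ioi_mem_nhds (show (-1 : ℝ) < 1 by norm_num)), self_mem_nhdsWithin]
    with t ht ht0 ht1
  have hI : 0 < ∫ θ in (0 : ℝ)..π, 1 / √(t + cos θ) := by
    have := dalpha1_pos ht0 ht1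
    rw [dalpha1_eq] at this
    exact pos_of_mul_pos_right this (by positivity)
  have hint : IntervalIntegrable (fun θ => 1 / √(t + cos θ)) volume 0 π := by
    by_contra h
    exact hI.ne' (intervalIntegral.integral_undef h)
  have hle : ∫ θ in (0 : ℝ)..x, 1 / √(t + cos θ) ≤ ∫ θ in (0 : ℝ)..π, 1 / √(t + cos θ) :=
    intervalIntegral.integral_mono_interval le_rfl hx0 hxπ.le
      (.of_forall fun θ => by simp only [Pi.zero_apply]; positivity) hint
  have h2 : 1 ≤ 2 * √2 := by linarith [Real.one_le_sqrt.2 (one_le_two (α := ℝ))]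
  rw [dalpha1_eq]
  nlinarith

/-- the inverse g = α₁⁻¹ of α₁ : [-1,∞) → [0,∞) is strictly increasing
and C¹ on [0,∞), with g'(s) = 1/(α₁'(g(s))) for s ∈ ℝ₊ \ {0,16}, g'(0) = 1/(2π)
and g'(16) = 0. -/
theorem alpha1_inverse_properties (g : ℝ → ℝ)
    (hg1 : ∀ e : ℝ, -1 ≤ e → g (alpha1 e) = e)
    (hg2 : ∀ s : ℝ, 0 ≤ s → -1 ≤ g s ∧ alpha1 (g s) = s) :
    StrictMonoOn g (Set.Ici (0:ℝ)) ∧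
    ContDiffOn ℝ 1 g (Set.Ici (0:ℝ)) ∧
    (∀ s : ℝ, 0 < s → s ≠ 16 → HasDerivAt g (1 / dalpha1 (g s)) s) ∧
    HasDerivWithinAt g (1 / (2 * π)) (Set.Ici (0:ℝ)) 0 ∧
    HasDerivAt g 0 16 := by
  have hmono : StrictMonoOn g (Ici 0) := fun s hs t ht hst => by
    by_contra! h
    have := alpha1_mono h
    rw [(hg2 s hs).2, (hg2 t ht).2] at this
    exact hst.not_ge this
  have hg0 : g 0 = -1 := by rw [← alpha1_neg_one]; exact hg1 _ le_rfl
  have hg16 : g 16 = 1 := by rw [← alpha1_one]; exact hg1 _ (by norm_num)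
  have hcont : ContinuousOn g (Ici 0) := by
    let G : Ici (0 : ℝ) → Ici (-1 : ℝ) := fun s => ⟨g s, (hg2 s s.2).1⟩
    have hG : Continuous G := by
      refine Monotone.continuous_of_surjective (fun s t h => hmono.monotoneOn s.2 t.2 h) fun e => ?_
      have he : 0 ≤ alpha1 e := alpha1_neg_one ▸ alpha1_mono e.2
      exact ⟨⟨alpha1 e, he⟩, Subtype.ext (hg1 e e.2)⟩
    exact continuousOn_iff_continuous_domRestrict.2 (continuous_subtype_val.comp hG)
  have hcontAt {s : ℝ} (hs : 0 < s) : ContinuousAt g s := hcont.continuousAt (Ici_mem_nhds hs)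
  have hgt {s : ℝ} (hs : 0 < s) : -1 < g s := hg0 ▸ hmono self_mem_Ici hs.le hs
  have hne {s : ℝ} (hs : 0 < s) (hs' : s ≠ 16) : g s ≠ 1 := fun h =>
    hs' (hmono.injOn hs.le (by norm_num : (0 : ℝ) ≤ 16) (h.trans hg16.symm))
  have hder (s : ℝ) (hs : 0 < s) (hs' : s ≠ 16) : HasDerivAt g (1 / dalpha1 (g s)) s := by
    rw [one_div]
    refine (hasDerivAt_alpha1 (hgt hs) (hne hs hs')).of_local_left_inverse (hcontAt hs)
      (dalpha1_pos (hgt hs) (hne hs hs')).ne' ?_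
    filter_upwards [Ioi_mem_nhds hs] with y hy using (hg2 y (le_of_lt hy)).2
  have hpos16 : ∀ᶠ s in 𝓝[≠] (16 : ℝ), 0 < s :=
    nhdsWithin_le_nhds (Ioi_mem_nhds (by norm_num))
  have hlt16 : ∀ᶠ s in 𝓝[>] (0 : ℝ), 0 < s ∧ s ≠ 16 := by
    filter_upwards [Ioo_mem_nhdsGT (show (0 : ℝ) < 16 by norm_num)] with s hs
    exact ⟨hs.1, hs.2.ne⟩
  have hlim0 : Tendsto (fun s => 1 / dalpha1 (g s)) (𝓝[>] 0) (𝓝 (1 / (2 * π))) := by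
    refine tendsto_const_nhds.div (tendsto_dalpha1_neg_one.comp ?_) (by positivity)
    refine tendsto_nhdsWithin_iff.2 ⟨?_, ?_⟩
    · rw [← hg0]
      exact (hcont 0 self_mem_Ici).mono_left (nhdsWithin_mono _ Ioi_subset_Ici_self)
    · filter_upwards [self_mem_nhdsWithin] with s hs using hgt hs
  have hlim16 : Tendsto (fun s => 1 / dalpha1 (g s)) (𝓝[≠] 16) (𝓝 0) := by
    simp only [one_div]
    refine tendsto_inv_atTop_zero.comp (tendsto_dalpha1_one.comp ?_)
    refine tendsto_nhdsWithin_iff.2 ⟨?_, ?_⟩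
    · rw [← hg16]
      exact (hcontAt (by norm_num)).tendsto.mono_left nhdsWithin_le_nhds
    · filter_upwards [self_mem_nhdsWithin, hpos16] with s hs hs0 using hne hs0 hs
  have hderiv0 : HasDerivWithinAt g (1 / (2 * π)) (Ici 0) 0 := by
    refine hasDerivWithinAt_Ici_of_tendsto_deriv (s := Ioo 0 16)
      (fun s hs => (hder s hs.1 hs.2.ne).differentiableAt.differentiableWithinAt)
      ((hcont 0 self_mem_Ici).mono fun s hs => hs.1.le) (Ioo_mem_nhdsGT (by norm_num))
      (hlim0.congr' ?_)
    filter_upwards [hlt16] with s hs using (hder s hs.1 hs.2).deriv.symm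
  have hderiv16 : HasDerivAt g 0 16 := by
    have hlim : Tendsto (deriv g) (𝓝[≠] 16) (𝓝 0) := by
      refine hlim16.congr' ?_
      filter_upwards [self_mem_nhdsWithin, hpos16] with s hs hs0 using (hder s hs0 hs).deriv.symm
    have hc : ContinuousAt g 16 := hcontAt (by norm_num)
    have hR : HasDerivWithinAt g 0 (Ici 16) 16 :=
      hasDerivWithinAt_Ici_of_tendsto_deriv (s := Ioi 16)
        (fun s hs => (hder s (lt_trans (by norm_num) hs)
          (ne_of_gt hs)).differentiableAt.differentiableWithinAt)
        hc.continuousWithinAt self_mem_nhdsWithin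
        (hlim.mono_left (nhdsWithin_mono _ fun s hs => ne_of_gt hs))
    have hL : HasDerivWithinAt g 0 (Iic 16) 16 :=
      hasDerivWithinAt_Iic_of_tendsto_deriv (s := Ioo 0 16)
        (fun s hs => (hder s hs.1 hs.2.ne).differentiableAt.differentiableWithinAt)
        hc.continuousWithinAt (Ioo_mem_nhdsLT (by norm_num))
        (hlim.mono_left (nhdsWithin_mono _ fun s hs => ne_of_lt hs))
    simpa [hasDerivWithinAt_univ] using hL.union hR
  have hdW {s : ℝ} (hs : 0 < s) (hs' : s ≠ 16) :
      derivWithin g (Ici 0) s = 1 / dalpha1 (g s) :=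
    (hder s hs hs').hasDerivWithinAt.derivWithin (uniqueDiffOn_Ici 0 s hs.le)
  refine ⟨hmono, (contDiffOn_one_iff_derivWithin (uniqueDiffOn_Ici 0)).2 ⟨?_, ?_⟩, hder,
    hderiv0, hderiv16⟩
  · intro s hs
    rcases eq_or_lt_of_le (mem_Ici.1 hs) with rfl | hs0
    · exact hderiv0.differentiableWithinAt
    by_cases hs' : s = 16
    · exact hs' ▸ hderiv16.differentiableAt.differentiableWithinAt
    · exact (hder s hs0 hs').differentiableAt.differentiableWithinAt
  · intro s hs
    rcases eq_or_lt_of_le (mem_Ici.1 hs) with rfl | hs0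
    · rw [← continuousWithinAt_Ioi_iff_Ici, ContinuousWithinAt,
        hderiv0.derivWithin (uniqueDiffOn_Ici 0 0 self_mem_Ici)]
      refine hlim0.congr' ?_
      filter_upwards [hlt16] with t ht using (hdW ht.1 ht.2).symm
    refine ContinuousAt.continuousWithinAt ?_
    by_cases hs' : s = 16
    · subst hs'
      rw [continuousAt_iff_punctured_nhds,
        hderiv16.hasDerivWithinAt.derivWithin (uniqueDiffOn_Ici 0 _ hs)]
      refine hlim16.congr' ?_
      filter_upwards [self_mem_nhdsWithin, hpos16] with t ht ht0 using (hdW ht0 ht).symm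
    · have hc : ContinuousAt (fun t => 1 / dalpha1 (g t)) s :=
        continuousAt_const.div (ContinuousAt.comp (g := dalpha1)
          (continuousAt_dalpha1 (hgt hs0) (hne hs0 hs')) (hcontAt hs0)) (dalpha1_pos (hgt hs0) (hne hs0 hs')).ne'
      refine hc.congr ?_
      filter_upwards [Ioi_mem_nhds hs0, isOpen_ne.mem_nhds hs'] with t ht ht'
        using (hdW ht ht').symm
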